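/- (Normalization identity for the evidence) Let π be a full-support prior policy. Then Z := Σ_h p_π(h)·exp R(h) satisfies Z = Σ_s p₁(s)·exp V_1(s); hence log Z = log Σ_s p₁(s)·exp V_1(s), where V_1 is the time-1 soft value of the soft Bellman recursion. -/

import Mathlib

/-- Probability of a trajectory `x` (index `i : Fin T` represents time `i+1`, so times run
over `1,…,T`) under initial distribution `p₁`, transition kernel `P` and policy `q`:
`p_q(h) = p₁(s₁) · ∏_{t=1}^T q_t(s_t,a_t) · ∏_{t=2}^T P(s_{t−1},a_{t−1},s_t)`. -/
noncomputable def pTraj {S A : Type} (T : ℕ) (p₁ : S → ℝ) (P : S → A → S → ℝ)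
    (q : ℕ → S → A → ℝ) (x : Fin T → S × A) : ℝ :=
  (if h0 : 0 < T then p₁ (x ⟨0, h0⟩).1 else 1) *
    (∏ i : Fin T, q (i.1 + 1) (x i).1 (x i).2) *
    ∏ i : Fin T, if hlt : i.1 + 1 < T then P (x i).1 (x i).2 (x ⟨i.1 + 1, hlt⟩).1 else 1

/-- Return of a trajectory: `R(h) = ∑_{t=1}^T R(s_t,a_t)`. -/
noncomputable def ret {S A : Type} (T : ℕ) (R : S → A → ℝ) (x : Fin T → S × A) : ℝ :=
  ∑ i : Fin T, R (x i).1 (x i).2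

/-- Value of a policy: `J(q) = ∑_h p_q(h)·R(h)`. -/
noncomputable def Jval {S A : Type} [Fintype S] [Fintype A] (T : ℕ) (p₁ : S → ℝ) (P : S → A → S → ℝ)
    (R : S → A → ℝ) (q : ℕ → S → A → ℝ) : ℝ :=
  ∑ x : Fin T → S × A, pTraj T p₁ P q x * ret T R x

/-- KL-regularized objective of `q` relative to the prior `π`:
`L(q) = ∑_{h : p_q(h)>0} p_q(h)·(R(h) + ∑_{t=1}^T log(π_t(s_t,a_t)/q_t(s_t,a_t)))`. -/
noncomputable def Lval {S A : Type} [Fintype S] [Fintype A] (T : ℕ) (p₁ : S → ℝ) (P : S → A → S → ℝ)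
    (R : S → A → ℝ) (π q : ℕ → S → A → ℝ) : ℝ :=
  ∑ x : Fin T → S × A,
    if 0 < pTraj T p₁ P q x then
      pTraj T p₁ P q x * (ret T R x +
        ∑ i : Fin T,
          Real.log (π (i.1 + 1) (x i).1 (x i).2 / q (i.1 + 1) (x i).1 (x i).2))
    else 0

/-- `q` is a (nonstationary) policy for times `1,…,T`. -/
def IsPolicy {S A : Type} [Fintype A] (T : ℕ) (q : ℕ → S → A → ℝ) : Prop :=
  ∀ t ∈ Finset.Icc 1 T, ∀ s : S, (∀ a : A, 0 ≤ q t s a) ∧ (∑ a : A, q t s a) = 1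

/-- `π` has full support: `π_t(s,a) > 0` for all `t,s,a`. -/
def FullSupport {S A : Type} (T : ℕ) (π : ℕ → S → A → ℝ) : Prop :=
  ∀ t ∈ Finset.Icc 1 T, ∀ (s : S) (a : A), 0 < π t s a

/-- `q` is absolutely continuous w.r.t. `π`: `q_t(s,a) > 0 → π_t(s,a) > 0`. -/
def AbsCont {S A : Type} (T : ℕ) (q π : ℕ → S → A → ℝ) : Prop :=
  ∀ t ∈ Finset.Icc 1 T, ∀ (s : S) (a : A), 0 < q t s a → 0 < π t s a

/-- KL divergence on a finite type: `KL(u‖v) = ∑_{x : u(x)>0} u(x)·log(u(x)/v(x))`. -/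
noncomputable def KL {X : Type} [Fintype X] (u v : X → ℝ) : ℝ :=
  ∑ x : X, if 0 < u x then u x * Real.log (u x / v x) else 0

lemma pTraj_cons {S A : Type} (n : ℕ) (ρ : S → ℝ) (P : S → A → S → ℝ)
    (q : ℕ → S → A → ℝ) (z : S × A) (y : Fin n → S × A) :
    pTraj (n + 1) ρ P q (Fin.cons z y) =
      ρ z.1 * q 1 z.1 z.2 * pTraj n (P z.1 z.2) P (fun t => q (t + 1)) y := by
  cases n with
  | zero => simp [pTraj]
  | succ m =>
    have hcons (k : ℕ) (hk : k + 1 < m + 2) :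
        (Fin.cons z y : Fin (m + 2) → S × A) ⟨k + 1, hk⟩ = y ⟨k, by omega⟩ := rfl
    have h1 : 1 < m + 1 + 1 := by omega
    unfold pTraj
    rw [Fin.prod_univ_succ, Fin.prod_univ_succ (n := m + 1)]
    simp only [Fin.cons_zero, Fin.cons_succ, Fin.val_succ, Fin.val_zero, hcons,
      Nat.zero_lt_succ, dite_true, zero_add, h1, Fin.zero_eta, Nat.add_lt_add_iff_right]
    ring

lemma ret_cons {S A : Type} (n : ℕ) (R : S → A → ℝ) (z : S × A) (y : Fin n → S × A) :
    ret (n + 1) R (Fin.cons z y) = R z.1 z.2 + ret n R y := by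
  simp [ret, Fin.sum_univ_succ]

/-- The evidence equals the initial average of any `U` satisfying the exponentiated soft Bellman
recursion. -/
lemma sum_pTraj_mul_exp_ret {S A : Type} [Fintype S] [Fintype A] (n : ℕ)
    (P : S → A → S → ℝ) (hPsum : ∀ s a, (∑ s' : S, P s a s') = 1) (R : S → A → ℝ)
    (ρ : S → ℝ) (hρ : (∑ s : S, ρ s) = 1) (q : ℕ → S → A → ℝ) (U : ℕ → S → ℝ)
    (hUn : ∀ s, U (n + 1) s = 1)
    (hU : ∀ t ∈ Finset.Icc 1 n, ∀ s, U t s =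
      ∑ a : A, q t s a * (Real.exp (R s a) * ∑ s' : S, P s a s' * U (t + 1) s')) :
    (∑ x : Fin n → S × A, pTraj n ρ P q x * Real.exp (ret n R x)) = ∑ s : S, ρ s * U 1 s := by
  induction n generalizing ρ q U with
  | zero => simp_all [pTraj, ret]
  | succ n ih =>
    have key (z : S × A) :
        (∑ y : Fin n → S × A, pTraj n (P z.1 z.2) P (fun t => q (t + 1)) y *
          Real.exp (ret n R y)) = ∑ s' : S, P z.1 z.2 s' * U 2 s' := by
      refine ih (P z.1 z.2) (hPsum _ _) (fun t => q (t + 1)) (fun t => U (t + 1)) hUn ?_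
      intro t ht s
      refine hU (t + 1) ?_ s
      simp only [Finset.mem_Icc] at ht ⊢
      omega
    rw [← (Fin.consEquiv fun _ : Fin (n + 1) => S × A).sum_comp, Fintype.sum_prod_type,
      Fintype.sum_prod_type]
    refine Finset.sum_congr rfl fun s _ => ?_
    rw [hU 1 (by simp) s, Finset.mul_sum]
    refine Finset.sum_congr rfl fun a _ => ?_
    rw [← key (s, a)]
    simp only [Finset.mul_sum]
    refine Finset.sum_congr rfl fun y _ => ?_
    change pTraj (n + 1) ρ P q (Fin.cons (s, a) y) *
      Real.exp (ret (n + 1) R (Fin.cons (s, a) y)) = _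
    rw [pTraj_cons, ret_cons, Real.exp_add]
    ring

/-- Normalization identity for the evidence:
`Z = ∑_h p_π(h)·exp R(h) = ∑_s p₁(s)·exp V_1(s)`, hence
`log Z = log ∑_s p₁(s)·exp V_1(s)`. -/
theorem stmt_9 {S A : Type} [Fintype S] [Fintype A] [Nonempty S] [Nonempty A]
    (T : ℕ) (hT : 1 ≤ T)
    (p₁ : S → ℝ) (hp₁ : ∀ s, 0 ≤ p₁ s) (hp₁sum : (∑ s : S, p₁ s) = 1)
    (P : S → A → S → ℝ) (hP : ∀ s a s', 0 ≤ P s a s')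
    (hPsum : ∀ s a, (∑ s' : S, P s a s') = 1)
    (R : S → A → ℝ)
    (π : ℕ → S → A → ℝ) (hπ : IsPolicy T π) (hπpos : FullSupport T π)
    (V : ℕ → S → ℝ) (Q : ℕ → S → A → ℝ)
    (hVT : ∀ s, V (T + 1) s = 0)
    (hQ : ∀ t ∈ Finset.Icc 1 T, ∀ (s : S) (a : A),
      Q t s a = R s a + Real.log (∑ s' : S, P s a s' * Real.exp (V (t + 1) s')))
    (hV : ∀ t ∈ Finset.Icc 1 T, ∀ s : S,
      V t s = Real.log (∑ a : A, π t s a * Real.exp (Q t s a))) :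
    (∑ x : Fin T → S × A, pTraj T p₁ P π x * Real.exp (ret T R x)) =
        (∑ s : S, p₁ s * Real.exp (V 1 s)) ∧
      Real.log (∑ x : Fin T → S × A, pTraj T p₁ P π x * Real.exp (ret T R x)) =
        Real.log (∑ s : S, p₁ s * Real.exp (V 1 s)) := by
  have sum_pos (t : ℕ) (s : S) (a : A) : 0 < ∑ s' : S, P s a s' * Real.exp (V t s') := by
    have hnn (s' : S) : 0 ≤ P s a s' * Real.exp (V t s') :=
      mul_nonneg (hP s a s') (Real.exp_nonneg _)
    refine (Finset.sum_nonneg fun s' _ => hnn s').lt_of_ne' fun h => ?_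
    rw [Finset.sum_eq_zero_iff_of_nonneg fun s' _ => hnn s'] at h
    have hzero : ∀ s', P s a s' = 0 := by simpa using h
    simpa [hzero] using hPsum s a
  have hZ : (∑ x : Fin T → S × A, pTraj T p₁ P π x * Real.exp (ret T R x)) =
      ∑ s : S, p₁ s * Real.exp (V 1 s) := by
    refine sum_pTraj_mul_exp_ret T P hPsum R p₁ hp₁sum π (fun t s => Real.exp (V t s))
      (by simp [hVT]) fun t ht s => ?_
    have hpos : 0 < ∑ a : A, π t s a * Real.exp (Q t s a) :=
      Finset.sum_pos (fun a _ => mul_pos (hπpos t ht s a) (Real.exp_pos _))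
        Finset.univ_nonempty
    rw [hV t ht s, Real.exp_log hpos]
    refine Finset.sum_congr rfl fun a _ => ?_
    rw [hQ t ht s a, Real.exp_add, Real.exp_log (sum_pos (t + 1) s a)]
  exact ⟨hZ, congrArg Real.log hZ⟩
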